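/- With P = k[x,y,z,w], Φ a degree-3 Macaulay inverse system, ann Φ containing no nonzero linear form, and p bijective, let SM be the symmetric 3×3 matrix over k built from Φ as in the context. Then the minimal number of generators of the ideal ann Φ (Submodule.spanRank) equals: 9 if SM = 0; 7 if SM has rank 1; and 6 if SM has rank at least 2. -/

import Mathlib

open MvPolynomial

noncomputable section

variable (k : Type*) [Field k]

/-- The annihilator ideal `ann Φ = {f : Φ(f·g) = 0 for all g}` of the
linear functional `Φ`. -/
def annIdeal (Φ : MvPolynomial (Fin 4) k →ₗ[k] k) : Ideal (MvPolynomial (Fin 4) k) where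
  carrier := {f | ∀ g, Φ (f * g) = 0}
  add_mem' := by
    intro a b ha hb g
    rw [add_mul, map_add, ha g, hb g, add_zero]
  zero_mem' := by intro g; simp
  smul_mem' := by
    intro c a ha g
    have h : c • a * g = a * (c * g) := by rw [smul_eq_mul]; ring
    rw [h]; exact ha (c * g)

/-- The Macaulay map `p : P₁ → Hom(P₁, k)`, `p(u)(v) = Φ(x·u·v)`. -/
def pMap (Φ : MvPolynomial (Fin 4) k →ₗ[k] k) :
    homogeneousSubmodule (Fin 4) k 1 →ₗ[k]
      (homogeneousSubmodule (Fin 4) k 1 →ₗ[k] k) where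
  toFun u :=
    { toFun := fun v => Φ (X 0 * u.1 * v.1)
      map_add' := fun v w => by simp [mul_add]
      map_smul' := fun c v => by simp [mul_smul_comm] }
  map_add' u u' := by
    ext v
    simp [add_mul, mul_add]
  map_smul' c u := by
    ext v
    simp [mul_smul_comm, smul_mul_assoc]

/-- The symmetric `3 × 3` matrix `SM` of (6.3), built from the Macaulay inverse
system `Φ` and the linear forms `ℓ_q` (`p⁻¹(q·Φ)` for the quadrics `q`);
here `⟨q,q'⟩ = Φ(q·ℓ_{q'})`. -/
def smMatrix (Φ : MvPolynomial (Fin 4) k →ₗ[k] k)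
    (ly2 lyz lyw lz2 lzw lw2 : MvPolynomial (Fin 4) k) : Matrix (Fin 3) (Fin 3) k :=
  !![Φ (X 2 ^ 2 * lw2) - Φ (X 2 * X 3 * lzw),
      Φ (X 2 * X 3 * lyw) - Φ (X 2 * X 1 * lw2),
      Φ (X 1 * X 2 * lzw) - Φ (X 2 ^ 2 * lyw);
    Φ (X 1 * X 3 * lzw) - Φ (X 1 * X 2 * lw2),
      Φ (X 1 ^ 2 * lw2) - Φ (X 1 * X 3 * lyw),
      Φ (X 1 * X 2 * lyw) - Φ (X 1 ^ 2 * lzw);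
    Φ (X 1 * X 2 * lzw) - Φ (X 1 * X 3 * lz2),
      Φ (X 1 * X 3 * lyz) - Φ (X 1 ^ 2 * lzw),
      Φ (X 1 ^ 2 * lz2) - Φ (X 1 * X 2 * lyz)]

/-- The least cardinality of a set generating the submodule `p`
(the minimal number of generators of `p`). -/
def Submodule.minSpanRank {R M : Type*} [Semiring R] [AddCommMonoid M] [Module R M]
    (p : Submodule R M) : Cardinal :=
  ⨅ s : {s : Set M // Submodule.span R s = p}, Cardinal.mk s.1

section helpers

variable {F : Type*} [Field F]

/-- The linear form with given coefficients. -/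
def lf : (Fin 4 → F) →ₗ[F] MvPolynomial (Fin 4) F :=
  Fintype.linearCombination F (X : Fin 4 → MvPolynomial (Fin 4) F)

lemma lf_single (i : Fin 4) : lf (Pi.single i (1 : F)) = X i := by
  simp [lf, Fintype.linearCombination_apply_single]

lemma lf_hom (u : Fin 4 → F) : (lf u).IsHomogeneous 1 := by
  rw [lf, Fintype.linearCombination_apply]
  refine IsHomogeneous.sum _ _ _ fun i _ => ?_
  exact (homogeneousSubmodule (Fin 4) F 1).smul_mem _ (isHomogeneous_X F i)

lemma lf_surj (f : MvPolynomial (Fin 4) F) (hf : f ∈ homogeneousSubmodule (Fin 4) F 1) :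
    ∃ u, lf u = f := by
  rw [homogeneousSubmodule_one_eq_span_X] at hf
  rw [← LinearMap.mem_range, lf, Fintype.range_linearCombination]
  exact hf

lemma lf_coeff (u : Fin 4 → F) (i : Fin 4) : coeff (Finsupp.single i 1) (lf u) = u i := by
  classical
  rw [lf, Fintype.linearCombination_apply]
  simp [coeff_sum, coeff_X, Finsupp.single_left_inj]

lemma lf_inj (u : Fin 4 → F) (h : lf u = 0) : u = 0 := by
  funext i
  rw [← lf_coeff u i, h]; simp

lemma Phi_hom (Φ : MvPolynomial (Fin 4) F →ₗ[F] F)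
    (hΦ : ∀ m : Fin 4 →₀ ℕ, (m.sum fun _ e => e) ≠ 3 → Φ (monomial m 1) = 0)
    {n : ℕ} (f : MvPolynomial (Fin 4) F) (hf : f.IsHomogeneous n) (hn : n ≠ 3) : Φ f = 0 := by
  rw [f.as_sum, map_sum]
  refine Finset.sum_eq_zero fun m hm => ?_
  have h1 : monomial m (coeff m f) = coeff m f • monomial m (1 : F) := by
    rw [smul_monomial]; simp
  rw [h1, map_smul, hΦ m, smul_zero]
  have h2 := hf (mem_support_iff.mp hm)
  rw [Pi.one_def, ← Finsupp.degree_eq_weight_one] at h2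
  intro h3
  exact hn (h2.symm.trans h3)

lemma degree_one_single (m : Fin 4 →₀ ℕ) (h : m.degree = 1) : ∃ i, m = Finsupp.single i 1 := by
  obtain ⟨i, hi⟩ : ∃ i, m i ≠ 0 := by
    by_contra! hc
    have : m = 0 := by ext i; exact hc i
    simp [this] at h
  have hle : Finsupp.single i 1 ≤ m := by
    simpa [Finsupp.single_le_iff] using Nat.one_le_iff_ne_zero.mpr hi
  have hm' : m = Finsupp.single i 1 + (m - Finsupp.single i 1) := by
    rw [add_tsub_cancel_of_le hle]
  generalize m - Finsupp.single i 1 = m' at hm'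
  subst hm'
  rw [map_add, Finsupp.degree_single] at h
  have : m' = 0 := (Finsupp.degree_eq_zero_iff m').mp (by omega)
  exact ⟨i, by simp [this]⟩

lemma mem_ann (Φ : MvPolynomial (Fin 4) F →ₗ[F] F)
    (hΦ : ∀ m : Fin 4 →₀ ℕ, (m.sum fun _ e => e) ≠ 3 → Φ (monomial m 1) = 0)
    {n : ℕ} (f : MvPolynomial (Fin 4) F) (hf : f.IsHomogeneous n)
    (h : ∀ m : Fin 4 →₀ ℕ, n + m.degree = 3 → Φ (f * monomial m 1) = 0) :
    f ∈ annIdeal F Φ := by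
  intro g
  rw [g.as_sum, Finset.mul_sum, map_sum]
  refine Finset.sum_eq_zero fun m hm => ?_
  have h1 : monomial m (coeff m g) = coeff m g • monomial m (1 : F) := by
    rw [smul_monomial]; simp
  rw [h1, mul_smul_comm, map_smul]
  by_cases h3 : n + m.degree = 3
  · rw [h m h3, smul_zero]
  · rw [Phi_hom Φ hΦ _ (hf.mul (isHomogeneous_monomial 1 rfl)) h3, smul_zero]

lemma ann_coeff (Φ : MvPolynomial (Fin 4) F →ₗ[F] F)
    (hΦ : ∀ m : Fin 4 →₀ ℕ, (m.sum fun _ e => e) ≠ 3 → Φ (monomial m 1) = 0)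
    (hB : ∀ u, (∀ v, Φ (X 0 * lf u * lf v) = 0) → u = 0)
    (f : MvPolynomial (Fin 4) F) (hf : f ∈ annIdeal F Φ) (i : Fin 4) :
    coeff (Finsupp.single i 1) f = 0 := by
  have key : ∀ (f : MvPolynomial (Fin 4) F) v, Φ (f * (X 0 * lf v)) =
      Φ (X 0 * lf (fun i => coeff (Finsupp.single i 1) f) * lf v) := by
    intro f v
    induction f using MvPolynomial.induction_on' with
    | monomial m a =>
      by_cases h : m.degree = 1
      · obtain ⟨i, rfl⟩ := degree_one_single m h
        have h1 : (fun j => coeff (Finsupp.single j 1) (monomial (Finsupp.single i 1) a)) =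
            a • Pi.single i (1 : F) := by
          funext j
          by_cases hij : i = j
          · subst hij; simp
          · have : ¬ (Finsupp.single i 1 = (Finsupp.single j 1 : Fin 4 →₀ ℕ)) := by
              simpa [Finsupp.single_left_inj] using hij
            simp [coeff_monomial, this, Ne.symm hij]
        have h2 : monomial (Finsupp.single i 1) a = a • (X i : MvPolynomial (Fin 4) F) := by
          rw [X, smul_monomial]; simp
        rw [h1, map_smul, lf_single, h2]
        congr 1
        simp only [smul_mul_assoc, mul_smul_comm]
        congr 1; ring
      · have h1 : (fun j => coeff (Finsupp.single j 1) (monomial m a)) = 0 := by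
          funext j
          have : m ≠ Finsupp.single j 1 := by
            rintro rfl; simp at h
          simp [coeff_monomial, this]
        rw [h1]
        rw [Phi_hom Φ hΦ (n := m.degree + (1 + 1)) _
          ((isHomogeneous_monomial a rfl).mul ((isHomogeneous_X F 0).mul (lf_hom v))) (by omega)]
        simp
    | add p q hp hq =>
      have h1 : (fun i => coeff (Finsupp.single i 1) (p + q)) =
        (fun i => coeff (Finsupp.single i 1) p) + (fun i => coeff (Finsupp.single i 1) q) := by
        funext i; simp
      rw [h1, add_mul, map_add, hp, hq, map_add, ← map_add]
      congr 1; ring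
  have := hB _ fun v => (key f v).symm.trans (hf _)
  exact congrFun this i

lemma lower {ι : Type} [Fintype ι] (I : Ideal (MvPolynomial (Fin 4) F))
    (L : MvPolynomial (Fin 4) F →ₗ[F] (ι → F))
    (hL : ∀ i, ∀ f ∈ I, L (X i * f) = 0) (hs : ∀ v, ∃ f ∈ I, L f = v) :
    (Fintype.card ι : Cardinal) ≤ Submodule.minSpanRank I := by
  have : Nonempty {s : Set (MvPolynomial (Fin 4) F) // Submodule.span _ s = I} :=
    ⟨⟨I, Submodule.span_eq I⟩⟩
  refine le_ciInf fun s => ?_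
  obtain ⟨s, rfl⟩ := s
  have h1 : ∀ f ∈ Submodule.span (MvPolynomial (Fin 4) F) s,
      L f ∈ Submodule.span F (L '' s) := by
    intro f hf
    induction hf using Submodule.span_induction with
    | mem x hx => exact Submodule.subset_span ⟨x, hx, rfl⟩
    | zero => simp
    | add x y _ _ hx hy => rw [map_add]; exact add_mem hx hy
    | smul p x hx ih =>
      rw [smul_eq_mul]
      induction p using MvPolynomial.induction_on with
      | C a => rw [C_mul', map_smul]; exact Submodule.smul_mem _ _ ih
      | add p q hp hq => rw [add_mul, map_add]; exact add_mem hp hq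
      | mul_X p i _ =>
        rw [mul_comm p, mul_assoc, hL i _ (Ideal.mul_mem_left _ _ hx)]
        exact zero_mem _
  have h2 : Submodule.span F (L '' s) = ⊤ := by
    rw [eq_top_iff]
    intro v _
    obtain ⟨f, hf, rfl⟩ := hs v
    exact h1 f hf
  have h3 := rank_span_le (R := F) (L '' s)
  rw [h2, rank_top, rank_fun'] at h3
  exact h3.trans Cardinal.mk_image_le

lemma upper {ι : Type} [Fintype ι] (I : Ideal (MvPolynomial (Fin 4) F))
    (g : ι → MvPolynomial (Fin 4) F) (hg : Ideal.span (Set.range g) = I) :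
    Submodule.minSpanRank I ≤ (Fintype.card ι : Cardinal) := by
  refine (ciInf_le' _ (⟨Set.range g, hg⟩ :
    {s : Set (MvPolynomial (Fin 4) F) // Submodule.span _ s = I})).trans ?_
  have := Cardinal.mk_range_le_lift (f := g)
  simpa using this

lemma psi_exists (Φ : MvPolynomial (Fin 4) F →ₗ[F] F) (τ : Fin 4 → MvPolynomial (Fin 4) F)
    (h : ∀ i j g, Φ (τ i * (X j * g)) = Φ (τ j * (X i * g))) :
    ∃ Ψ : MvPolynomial (Fin 4) F →ₗ[F] F, ∀ i g, Ψ (X i * g) = Φ (τ i * g) := by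
  classical
  let θ : (Fin 4 →₀ ℕ) → F := fun m =>
    if h : ∃ i, m i ≠ 0 then Φ (τ h.choose * monomial (m - Finsupp.single h.choose 1) 1) else 0
  refine ⟨(basisMonomials (Fin 4) F).constr F θ, fun i g => ?_⟩
  have hm : ∀ m, (basisMonomials (Fin 4) F).constr F θ (monomial m 1) = θ m := fun m => by
    rw [← (basisMonomials (Fin 4) F).constr_basis F θ m, coe_basisMonomials]
  induction g using MvPolynomial.induction_on' with
  | monomial m a =>
    have h1 : monomial m a = a • monomial m (1 : F) := by
      rw [smul_monomial]; simp
    rw [h1, mul_smul_comm, map_smul, mul_smul_comm, map_smul]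
    congr 1
    rw [X, monomial_mul, one_mul, hm]
    have hex : ∃ j, (Finsupp.single i 1 + m : Fin 4 →₀ ℕ) j ≠ 0 := ⟨i, by simp⟩
    simp only [θ]
    rw [dif_pos hex]
    have hj := hex.choose_spec
    generalize hex.choose = j at hj
    by_cases hij : i = j
    · subst hij; simp
    · have hmj : m j ≠ 0 := by simpa [Finsupp.single_apply, hij] using hj
      have hm' : m = Finsupp.single j 1 + (m - Finsupp.single j 1) := by
        rw [add_tsub_cancel_of_le]
        simpa [Finsupp.single_le_iff] using Nat.one_le_iff_ne_zero.mpr hmj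
      generalize m - Finsupp.single j 1 = m' at hm'
      subst hm'
      have e1 : Finsupp.single i 1 + (Finsupp.single j 1 + m') - Finsupp.single j 1 =
        Finsupp.single i 1 + m' := by
        rw [add_left_comm]; simp
      rw [e1]
      have e2 : ∀ l : Fin 4, monomial (Finsupp.single l 1 + m') (1 : F) = X l * monomial m' 1 := by
        intro l; rw [X, monomial_mul, one_mul]
      rw [e2, e2]
      exact h j i _
  | add p q hp hq => simp only [mul_add, map_add, hp, hq]

lemma pi_ind (p : (Fin 4 → F) → Prop) (hadd : ∀ u v, p u → p v → p (u + v))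
    (hsmul : ∀ (a : F) u, p u → p (a • u)) (hs : ∀ i, p (Pi.single i 1)) (u : Fin 4 → F) :
    p u := by
  have h : u = u 0 • Pi.single 0 1 + u 1 • Pi.single 1 1 + u 2 • Pi.single 2 1
      + u 3 • Pi.single 3 1 := by
    funext i
    fin_cases i <;> simp
  rw [h]
  exact hadd _ _ (hadd _ _ (hadd _ _ (hsmul _ _ (hs 0)) (hsmul _ _ (hs 1)))
    (hsmul _ _ (hs 2))) (hsmul _ _ (hs 3))

/-- The bilinear form. -/
def BM (Φ : MvPolynomial (Fin 4) F →ₗ[F] F) : (Fin 4 → F) →ₗ[F] (Fin 4 → F) →ₗ[F] F :=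
  LinearMap.mk₂ F (fun u v => Φ (X 0 * lf u * lf v))
    (fun u v w => by simp only [map_add, mul_add, add_mul])
    (fun c u v => by simp only [map_smul, mul_smul_comm, smul_mul_assoc])
    (fun u v w => by simp only [map_add, mul_add])
    (fun c u v => by simp only [map_smul, mul_smul_comm])

lemma BM_apply (Φ : MvPolynomial (Fin 4) F →ₗ[F] F) (u v : Fin 4 → F) :
    BM Φ u v = Φ (X 0 * lf u * lf v) := rfl

lemma BM_comm (Φ : MvPolynomial (Fin 4) F →ₗ[F] F) (u v : Fin 4 → F) :
    BM Φ u v = BM Φ v u := by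
  rw [BM_apply, BM_apply]; exact congrArg Φ (by ring)

section mu

variable {Φ : MvPolynomial (Fin 4) F →ₗ[F] F}
  {μ : (Fin 4 → F) →ₗ[F] (Fin 4 → F) →ₗ[F] (Fin 4 → F)}

lemma BM_ext (hB : ∀ u, (∀ v, BM Φ u v = 0) → u = 0) (u v : Fin 4 → F)
    (h : ∀ w, BM Φ u w = BM Φ v w) : u = v := by
  rw [← sub_eq_zero]
  apply hB
  intro w
  rw [map_sub, LinearMap.sub_apply, h, sub_self]

lemma mu_comm (hB : ∀ u, (∀ v, BM Φ u v = 0) → u = 0)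
    (hμ : ∀ u v w, BM Φ (μ u v) w = Φ (lf u * lf v * lf w)) (u v : Fin 4 → F) :
    μ u v = μ v u := by
  apply BM_ext hB
  intro w
  rw [hμ, hμ, mul_comm (lf u)]

lemma mu_one (hB : ∀ u, (∀ v, BM Φ u v = 0) → u = 0)
    (hμ : ∀ u v w, BM Φ (μ u v) w = Φ (lf u * lf v * lf w)) (v : Fin 4 → F) :
    μ (Pi.single 0 1) v = v := by
  apply BM_ext hB
  intro w
  rw [hμ, lf_single, BM_apply]

/-- First indices. -/
def q1 : Fin 6 → Fin 4 := ![1, 1, 1, 2, 2, 3]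
/-- Second indices. -/
def q2 : Fin 6 → Fin 4 := ![1, 2, 3, 2, 3, 3]

/-- The six quadrics. -/
def gq (μ : (Fin 4 → F) →ₗ[F] (Fin 4 → F) →ₗ[F] (Fin 4 → F)) (a : Fin 6) :
    MvPolynomial (Fin 4) F :=
  X (q1 a) * X (q2 a) - X 0 * lf (μ (Pi.single (q1 a) 1) (Pi.single (q2 a) 1))

lemma F1 (hB : ∀ u, (∀ v, BM Φ u v = 0) → u = 0)
    (hμ : ∀ u v w, BM Φ (μ u v) w = Φ (lf u * lf v * lf w))
    (K : Ideal (MvPolynomial (Fin 4) F)) (hK : ∀ a, gq μ a ∈ K) (u v : Fin 4 → F) :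
    lf u * lf v - X 0 * lf (μ u v) ∈ K := by
  revert v
  refine pi_ind (fun u => ∀ v, lf u * lf v - X 0 * lf (μ u v) ∈ K) ?_ ?_ ?_ u
  · intro u u' h h' v
    convert K.add_mem (h v) (h' v) using 1
    simp only [map_add, LinearMap.add_apply]; ring
  · intro a u h v
    convert Submodule.smul_of_tower_mem K a (h v) using 1
    simp only [map_smul, LinearMap.smul_apply, smul_mul_assoc, mul_smul_comm, smul_sub]
  intro i v
  refine pi_ind (fun v => lf (Pi.single i 1) * lf v - X 0 * lf (μ (Pi.single i 1) v) ∈ K)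
    ?_ ?_ ?_ v
  · intro u u' h h'
    convert K.add_mem h h' using 1
    simp only [map_add]; ring
  · intro a u h
    convert Submodule.smul_of_tower_mem K a h using 1
    simp only [map_smul, smul_mul_assoc, mul_smul_comm, smul_sub]
  intro j
  have hsymm : ∀ i j : Fin 4, lf (Pi.single i 1) * lf (Pi.single j 1)
      - X 0 * lf (μ (Pi.single i 1) (Pi.single j 1)) ∈ K →
      lf (Pi.single j 1) * lf (Pi.single i 1)
      - X 0 * lf (μ (Pi.single j 1) (Pi.single i 1)) ∈ K := by
    intro i j h
    rw [mu_comm hB hμ, mul_comm (lf _)]; exact h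
  have h0 : ∀ j : Fin 4, lf (Pi.single 0 1) * lf (Pi.single j 1)
      - X 0 * lf (μ (Pi.single 0 1) (Pi.single j 1)) ∈ K := by
    intro j
    rw [mu_one hB hμ, lf_single, sub_self]; exact K.zero_mem
  have hq : ∀ a : Fin 6, lf (Pi.single (q1 a) 1) * lf (Pi.single (q2 a) 1)
      - X 0 * lf (μ (Pi.single (q1 a) 1) (Pi.single (q2 a) 1)) ∈ K := by
    intro a
    rw [lf_single, lf_single]; exact hK a
  fin_cases i <;> fin_cases j
  · exact h0 0
  · exact h0 1
  · exact h0 2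
  · exact h0 3
  · exact hsymm _ _ (h0 1)
  · exact hq 0
  · exact hq 1
  · exact hq 2
  · exact hsymm _ _ (h0 2)
  · exact hsymm _ _ (hq 1)
  · exact hq 3
  · exact hq 4
  · exact hsymm _ _ (h0 3)
  · exact hsymm _ _ (hq 2)
  · exact hsymm _ _ (hq 4)
  · exact hq 5

/-- The condition defining the radical. -/
def ZC (Φ : MvPolynomial (Fin 4) F →ₗ[F] F)
    (μ : (Fin 4 → F) →ₗ[F] (Fin 4 → F) →ₗ[F] (Fin 4 → F)) (s : Fin 4 → F) : Prop :=
  ∀ u v w, BM Φ (μ u v) (μ s w) = BM Φ (μ s u) (μ v w)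

/-- Elements `d` with `x² d ∈ K`. -/
lemma F0 (hB : ∀ u, (∀ v, BM Φ u v = 0) → u = 0)
    (hBs : ∀ f : (Fin 4 → F) →ₗ[F] F, ∃ t, BM Φ t = f)
    (hμ : ∀ u v w, BM Φ (μ u v) w = Φ (lf u * lf v * lf w))
    (K : Ideal (MvPolynomial (Fin 4) F)) (hK : ∀ a, gq μ a ∈ K) (d : Fin 4 → F)
    (hd : ∀ s, ZC Φ μ s → BM Φ s d = 0) : X 0 ^ 2 * lf d ∈ K := by
  let Q : Submodule F (Fin 4 → F) :=
    { carrier := {d | X 0 ^ 2 * lf d ∈ K}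
      add_mem' := by
        intro a b ha hb
        simp only [Set.mem_ofPred_eq, map_add, mul_add] at *
        exact K.add_mem ha hb
      zero_mem' := by simp
      smul_mem' := by
        intro c a ha
        simp only [Set.mem_ofPred_eq, map_smul, mul_smul_comm] at *
        exact Submodule.smul_of_tower_mem K c ha }
  by_contra hc
  have hdQ : d ∉ Q := hc
  obtain ⟨f, hfd, hQ⟩ := Submodule.exists_le_ker_of_notMem hdQ
  obtain ⟨s, rfl⟩ := hBs f
  apply hfd
  apply hd
  intro u v w
  have hF := F1 hB hμ K hK
  have hmem : μ (μ u v) w - μ u (μ v w) ∈ Q := by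
    change X 0 ^ 2 * lf _ ∈ K
    have h1 := K.mul_mem_left (X 0) (hF (μ u v) w)
    have h2 := K.mul_mem_left (lf w) (hF u v)
    have h3 := K.mul_mem_left (lf u) (hF v w)
    have h4 := K.mul_mem_left (X 0) (hF u (μ v w))
    convert K.sub_mem (K.sub_mem (K.add_mem h3 h4) h2) h1 using 1
    rw [map_sub]; ring
  have h5 := hQ hmem
  rw [LinearMap.mem_ker, map_sub, sub_eq_zero] at h5
  have e1 : BM Φ s (μ (μ u v) w) = BM Φ (μ u v) (μ s w) := by
    rw [BM_comm, hμ, BM_comm, hμ]; exact congrArg Φ (by ring)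
  have e2 : BM Φ s (μ u (μ v w)) = BM Φ (μ s u) (μ v w) := by
    rw [BM_comm, hμ, hμ]; exact congrArg Φ (by ring)
  rw [← e1, ← e2, h5]

lemma psi_of_ZC (hΦ : ∀ m : Fin 4 →₀ ℕ, (m.sum fun _ e => e) ≠ 3 → Φ (monomial m 1) = 0)
    (hB : ∀ u, (∀ v, BM Φ u v = 0) → u = 0)
    (hμ : ∀ u v w, BM Φ (μ u v) w = Φ (lf u * lf v * lf w)) (t : Fin 4 → F) (ht : ZC Φ μ t) :
    ∃ Ψ : MvPolynomial (Fin 4) F →ₗ[F] F,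
      ∀ i g, Ψ (X i * g) = Φ (lf (μ t (Pi.single i 1)) * g) := by
  refine psi_exists Φ (fun i => lf (μ t (Pi.single i 1))) ?_
  intro i j g
  induction g using MvPolynomial.induction_on' with
  | monomial m a =>
    have h1 : monomial m a = a • monomial m (1 : F) := by
      rw [smul_monomial]; simp
    simp only [h1, mul_smul_comm, map_smul]
    congr 1
    by_cases h : m.degree = 1
    · obtain ⟨l, rfl⟩ := degree_one_single m h
      have h2 := ht (Pi.single i 1) (Pi.single l 1) (Pi.single j 1)
      rw [hμ, BM_comm, hμ, lf_single, lf_single, lf_single] at h2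
      change Φ (_ * (_ * X l)) = Φ (_ * (_ * X l))
      trans Φ (X l * X j * lf (μ t (Pi.single i 1)))
      · exact congrArg Φ (by ring)
      · rw [← h2]; exact congrArg Φ (by ring)
    · rw [Phi_hom Φ hΦ (n := 1 + (1 + m.degree)) _ ((lf_hom _).mul ((isHomogeneous_X F _).mul
        (isHomogeneous_monomial 1 rfl))) (by omega),
        Phi_hom Φ hΦ (n := 1 + (1 + m.degree)) _ ((lf_hom _).mul ((isHomogeneous_X F _).mul
        (isHomogeneous_monomial 1 rfl))) (by omega)]
  | add p q hp hq => simp only [mul_add, map_add, hp, hq]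

lemma q_inj : ∀ a b : Fin 6, (∀ i : Fin 4, ((if q1 a = i then 1 else 0) +
    (if q2 a = i then 1 else 0) : ℕ) = (if q1 b = i then 1 else 0) +
    (if q2 b = i then 1 else 0)) → a = b := by
  decide

lemma q1_ne : ∀ a : Fin 6, q1 a ≠ 0 := by decide

lemma q2_ne : ∀ a : Fin 6, q2 a ≠ 0 := by decide

/-- Exponents of the quadratic monomials. -/
def qm (a : Fin 6) : Fin 4 →₀ ℕ := Finsupp.single (q1 a) 1 + Finsupp.single (q2 a) 1

lemma qm_inj (a b : Fin 6) (h : qm a = qm b) : a = b := by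
  apply q_inj
  intro i
  have := DFunLike.congr_fun h i
  simpa [qm, Finsupp.single_apply] using this

lemma coeff_qm_X0 (a : Fin 6) (f : MvPolynomial (Fin 4) F) : coeff (qm a) (X 0 * f) = 0 := by
  classical
  rw [coeff_X_mul', if_neg]
  simp [qm, Finsupp.single_apply, q1_ne, q2_ne]

lemma coeff_qm_gq (μ : (Fin 4 → F) →ₗ[F] (Fin 4 → F) →ₗ[F] (Fin 4 → F)) (a b : Fin 6) :
    coeff (qm a) (gq μ b) = if b = a then 1 else 0 := by
  classical
  rw [gq, coeff_sub, coeff_qm_X0, sub_zero, X, X, monomial_mul, one_mul, coeff_monomial]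
  by_cases h : b = a
  · subst h; simp [qm]
  · rw [if_neg h, if_neg]
    intro h'
    exact h (qm_inj b a h')

lemma coeff_qm_mI (a : Fin 6) (i : Fin 4) (f : MvPolynomial (Fin 4) F)
    (hf : ∀ j, coeff (Finsupp.single j 1) f = 0) : coeff (qm a) (X i * f) = 0 := by
  classical
  rw [coeff_X_mul']
  split_ifs with h
  · by_cases h1 : q1 a = i
    · have : qm a - Finsupp.single i 1 = Finsupp.single (q2 a) 1 := by
        rw [qm, h1]; simp
      rw [this, hf]
    · have h2 : q2 a = i := by
        by_contra h2
        simp [qm, Finsupp.single_apply, h1, h2] at h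
      have : qm a - Finsupp.single i 1 = Finsupp.single (q1 a) 1 := by
        rw [qm, h2]; simp
      rw [this, hf]
  · rfl

lemma gq_hom (a : Fin 6) : (gq μ a).IsHomogeneous 2 :=
  ((isHomogeneous_X F _).mul (isHomogeneous_X F _)).sub ((isHomogeneous_X F 0).mul (lf_hom _))

lemma gq_mem (hΦ : ∀ m : Fin 4 →₀ ℕ, (m.sum fun _ e => e) ≠ 3 → Φ (monomial m 1) = 0)
    (hμ : ∀ u v w, BM Φ (μ u v) w = Φ (lf u * lf v * lf w)) (a : Fin 6) :
    gq μ a ∈ annIdeal F Φ := by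
  refine mem_ann Φ hΦ _ (gq_hom a) fun m hm => ?_
  obtain ⟨i, rfl⟩ := degree_one_single m (by omega)
  change Φ (gq μ a * X i) = 0
  have := hμ (Pi.single (q1 a) 1) (Pi.single (q2 a) 1) (Pi.single i 1)
  rw [BM_apply, lf_single, lf_single, lf_single] at this
  rw [gq, sub_mul, map_sub, this, sub_self]

lemma x2_hom (c : Fin 4 → F) : (X 0 ^ 2 * lf c).IsHomogeneous 3 :=
  ((isHomogeneous_X F 0).pow 2).mul (lf_hom c)

lemma x2_val (Φ : MvPolynomial (Fin 4) F →ₗ[F] F) (c : Fin 4 → F) :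
    Φ (X 0 ^ 2 * lf c) = BM Φ (Pi.single 0 1) c := by
  rw [BM_apply, lf_single, sq]

lemma x2_mem (hΦ : ∀ m : Fin 4 →₀ ℕ, (m.sum fun _ e => e) ≠ 3 → Φ (monomial m 1) = 0)
    (c : Fin 4 → F) (hc : BM Φ (Pi.single 0 1) c = 0) : X 0 ^ 2 * lf c ∈ annIdeal F Φ := by
  refine mem_ann Φ hΦ _ (x2_hom c) fun m hm => ?_
  have : m = 0 := (Finsupp.degree_eq_zero_iff m).mp (by omega)
  subst this
  have h1 : (monomial (0 : Fin 4 →₀ ℕ)) (1 : F) = 1 := rfl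
  rw [h1, mul_one, x2_val, hc]

/-- The ideal generated by all candidates is the whole annihilator. -/
lemma ann_le (hΦ : ∀ m : Fin 4 →₀ ℕ, (m.sum fun _ e => e) ≠ 3 → Φ (monomial m 1) = 0)
    (hB : ∀ u, (∀ v, BM Φ u v = 0) → u = 0)
    (hμ : ∀ u v w, BM Φ (μ u v) w = Φ (lf u * lf v * lf w))
    (K : Ideal (MvPolynomial (Fin 4) F)) (hK : ∀ a, gq μ a ∈ K) (hKI : K ≤ annIdeal F Φ)
    (c0 : Fin 4 → F) (hc0 : BM Φ (Pi.single 0 1) c0 = 1)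
    (F2 : ∀ u, X 0 ^ 2 * lf u - BM Φ (Pi.single 0 1) u • (X 0 ^ 2 * lf c0) ∈ K) :
    annIdeal F Φ ≤ K := by
  have hF := F1 hB hμ K hK
  have F3a : X 0 ^ 3 * lf c0 ∈ K := by
    obtain ⟨c, hc, hcne⟩ := Submodule.exists_mem_ne_zero_of_ne_bot
      (LinearMap.ker_ne_bot_of_finrank_lt (f := BM Φ (Pi.single 0 1)) (by simp))
    have hv : ∃ v, BM Φ c v ≠ 0 := by
      by_contra! h
      exact hcne (hB c h)
    obtain ⟨v, hv⟩ := hv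
    have h1 := F2 c
    rw [LinearMap.mem_ker.mp hc, zero_smul, sub_zero] at h1
    have h2 := K.mul_mem_left (lf v) h1
    have h3 := K.mul_mem_left (X 0 ^ 2) (hF c v)
    have h4 := K.mul_mem_left (X 0) (F2 (μ c v))
    have e : BM Φ (Pi.single 0 1) (μ c v) = BM Φ c v := by
      rw [BM_comm, hμ, BM_apply, lf_single]; exact congrArg Φ (by ring)
    rw [e] at h4
    have h5 := K.sub_mem h2 (K.add_mem h3 h4)
    have h6 : BM Φ c v • (X 0 ^ 3 * lf c0) ∈ K := by
      convert h5 using 1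
      simp only [smul_eq_C_mul]; ring
    have h7 := Submodule.smul_of_tower_mem K (BM Φ c v)⁻¹ h6
    rwa [smul_smul, inv_mul_cancel₀ hv, one_smul] at h7
  have F3 : ∀ u, X 0 ^ 3 * lf u ∈ K := by
    intro u
    have h1 := K.mul_mem_left (X 0) (F2 u)
    have h2 := Submodule.smul_of_tower_mem K (BM Φ (Pi.single 0 1) u) F3a
    convert K.add_mem h1 h2 using 1
    simp only [smul_eq_C_mul]; ring
  have dec : ∀ f : MvPolynomial (Fin 4) F, ∃ (a : F) (u v : Fin 4 → F) (b : F),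
      f - (C a + lf u + X 0 * lf v + C b * (X 0 ^ 2 * lf c0)) ∈ K := by
    intro f
    induction f using MvPolynomial.induction_on with
    | C a => exact ⟨a, 0, 0, 0, by simp⟩
    | add p q hp hq =>
      obtain ⟨a, u, v, b, h⟩ := hp
      obtain ⟨a', u', v', b', h'⟩ := hq
      refine ⟨a + a', u + u', v + v', b + b', ?_⟩
      convert K.add_mem h h' using 1
      simp only [map_add]; ring
    | mul_X p i hp =>
      obtain ⟨a, u, v, b, h⟩ := hp
      refine ⟨0, a • Pi.single i 1, μ (Pi.single i 1) u,
        BM Φ (Pi.single 0 1) (μ (Pi.single i 1) v), ?_⟩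
      have h1 := K.mul_mem_left (X i) h
      have h2 := hF (Pi.single i 1) u
      have h3 := K.mul_mem_left (X 0) (hF (Pi.single i 1) v)
      have h4 := F2 (μ (Pi.single i 1) v)
      have h5 := K.mul_mem_left (C b * X 0 ^ 2) (hF (Pi.single i 1) c0)
      have h6 := K.mul_mem_left (C b) (F3 (μ (Pi.single i 1) c0))
      convert K.add_mem (K.add_mem (K.add_mem h1 h2) (K.add_mem h3 h4)) (K.add_mem h5 h6) using 1
      simp only [map_smul, lf_single, smul_eq_C_mul, C_0]; ring
  intro f hf
  obtain ⟨a, u, v, b, h⟩ := dec f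
  have hr : C a + lf u + X 0 * lf v + C b * (X 0 ^ 2 * lf c0) ∈ annIdeal F Φ := by
    have := (annIdeal F Φ).sub_mem hf (hKI h)
    rwa [sub_sub_cancel] at this
  have hC : ∀ (a : F), (C a : MvPolynomial (Fin 4) F).IsHomogeneous 0 := isHomogeneous_C _
  have hX := isHomogeneous_X F (0 : Fin 4)
  have hb := (hC b).mul (x2_hom c0)
  have ha : a = 0 := by
    have := hr (X 0 ^ 2 * lf c0)
    rw [add_mul, add_mul, add_mul, map_add, map_add, map_add, C_mul', map_smul, x2_val, hc0,
      Phi_hom Φ hΦ _ ((lf_hom u).mul (x2_hom c0)) (by omega),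
      Phi_hom Φ hΦ _ ((hX.mul (lf_hom v)).mul (x2_hom c0)) (by omega),
      Phi_hom Φ hΦ _ (hb.mul (x2_hom c0)) (by omega)] at this
    simpa using this
  subst ha
  rw [C_0, zero_add] at hr h
  have hu : u = 0 := by
    apply hB
    intro w
    have := hr (X 0 * lf w)
    rw [add_mul, add_mul, map_add, map_add,
      Phi_hom Φ hΦ _ ((hX.mul (lf_hom v)).mul (hX.mul (lf_hom w))) (by omega),
      Phi_hom Φ hΦ _ (hb.mul (hX.mul (lf_hom w))) (by omega), add_zero, add_zero] at this
    rw [BM_apply, ← this]; exact congrArg Φ (by ring)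
  subst hu
  rw [map_zero, zero_add] at hr h
  have hv : v = 0 := by
    apply hB
    intro w
    have := hr (lf w)
    rw [add_mul, map_add, Phi_hom Φ hΦ _ (hb.mul (lf_hom w)) (by omega), add_zero] at this
    exact this
  subst hv
  rw [map_zero, mul_zero, zero_add] at hr h
  have hb0 : b = 0 := by
    have := hr 1
    rw [mul_one, C_mul', map_smul, x2_val, hc0] at this
    simpa using this
  subst hb0
  simpa using h

theorem general (hΦ : ∀ m : Fin 4 →₀ ℕ, (m.sum fun _ e => e) ≠ 3 → Φ (monomial m 1) = 0)
    (hB : ∀ u, (∀ v, BM Φ u v = 0) → u = 0)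
    (hBs : ∀ f : (Fin 4 → F) →ₗ[F] F, ∃ t, BM Φ t = f)
    (hμ : ∀ u v w, BM Φ (μ u v) w = Φ (lf u * lf v * lf w))
    (r : ℕ) (t : Fin (r + 1) → (Fin 4 → F)) (ht0 : t 0 = Pi.single 0 1)
    (hli : LinearIndependent F t) (htZ : ∀ i, ZC Φ μ (t i))
    (hspan : ∀ s, ZC Φ μ s → s ∈ Submodule.span F (Set.range t)) :
    Submodule.minSpanRank (annIdeal F Φ) = ((6 + r : ℕ) : Cardinal) := by
  classical
  -- dual family
  have hc : ∃ c : Fin (r + 1) → (Fin 4 → F), ∀ i j, BM Φ (t i) (c j) = if i = j then 1 else 0 := by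
    obtain ⟨g, hg⟩ := LinearMap.exists_leftInverse_of_injective
      (Fintype.linearCombination F t) (by
        rw [LinearMap.ker_eq_bot]
        exact linearIndependent_iff_injective_fintypeLinearCombination.mp hli)
    choose c hc using fun j : Fin (r + 1) => hBs ((LinearMap.proj j).comp g)
    refine ⟨c, fun i j => ?_⟩
    rw [BM_comm, hc j]
    have h1 := LinearMap.congr_fun hg (Pi.single i 1)
    rw [LinearMap.comp_apply, Fintype.linearCombination_apply_single, one_smul] at h1
    rw [LinearMap.comp_apply, h1]
    simp [Pi.single_apply, eq_comm]
  obtain ⟨c, hc⟩ := hc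
  let G : Fin 6 ⊕ Fin r → MvPolynomial (Fin 4) F :=
    Sum.elim (gq μ) (fun j => X 0 ^ 2 * lf (c j.succ))
  have hGI : ∀ x, G x ∈ annIdeal F Φ := by
    rintro (a | j)
    · exact gq_mem hΦ hμ a
    · refine x2_mem hΦ _ ?_
      rw [← ht0, hc]
      simp [(Fin.succ_ne_zero j).symm]
  have hcard : Fintype.card (Fin 6 ⊕ Fin r) = 6 + r := by simp
  rw [← hcard]
  apply le_antisymm
  · apply upper _ G
    have hKI : Ideal.span (Set.range G) ≤ annIdeal F Φ := by
      rw [Ideal.span_le]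
      rintro _ ⟨x, rfl⟩
      exact hGI x
    apply le_antisymm hKI
    have hK : ∀ a, gq μ a ∈ Ideal.span (Set.range G) :=
      fun a => Ideal.subset_span ⟨Sum.inl a, rfl⟩
    have hK2 : ∀ j : Fin r, X 0 ^ 2 * lf (c j.succ) ∈ Ideal.span (Set.range G) :=
      fun a => Ideal.subset_span ⟨Sum.inr a, rfl⟩
    refine ann_le hΦ hB hμ _ hK hKI (c 0) (by rw [← ht0, hc]; simp) ?_
    intro u
    have h1 := F0 hB hBs hμ _ hK (u - ∑ j, BM Φ (t j) u • c j) (by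
      intro s hs
      have hs' := hspan s hs
      clear hs
      induction hs' using Submodule.span_induction with
      | mem x hx =>
        obtain ⟨i, rfl⟩ := hx
        simp [hc]
      | zero => simp
      | add x y _ _ hx hy => rw [map_add, LinearMap.add_apply, hx, hy, add_zero]
      | smul a x _ hx => rw [map_smul, LinearMap.smul_apply, hx, smul_zero])
    have h2 : X 0 ^ 2 * lf (∑ j : Fin r, BM Φ (t j.succ) u • c j.succ) ∈
        Ideal.span (Set.range G) := by
      rw [map_sum, Finset.mul_sum]
      refine Ideal.sum_mem _ fun j _ => ?_
      rw [map_smul, mul_smul_comm]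
      exact Submodule.smul_of_tower_mem _ _ (hK2 j)
    convert Ideal.add_mem _ h1 h2 using 1
    rw [Fin.sum_univ_succ, ← ht0, map_sub, map_add, map_smul, smul_eq_C_mul, smul_eq_C_mul]
    ring
  · choose Ψ hΨ using fun i => psi_of_ZC hΦ hB hμ (t i) (htZ i)
    let L : MvPolynomial (Fin 4) F →ₗ[F] (Fin 6 ⊕ Fin r → F) :=
      LinearMap.pi (Sum.elim (fun a => lcoeff F (qm a)) (fun j => Ψ j.succ))
    have hLl : ∀ f a, L f (Sum.inl a) = coeff (qm a) f := fun f a => rfl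
    have hLr : ∀ f j, L f (Sum.inr j) = Ψ j.succ f := fun f a => rfl
    refine lower _ L ?_ ?_
    · intro i f hf
      funext x
      rcases x with a | j
      · rw [hLl]
        exact coeff_qm_mI a i f (ann_coeff Φ hΦ hB f hf)
      · rw [hLr, hΨ, mul_comm]
        exact hf _
    · have hLG : ∀ x, L (G x) = Pi.single x 1 := by
        rintro (b | b)
        · funext x
          rcases x with a | j
          · rw [hLl]
            change coeff (qm a) (gq μ b) = _
            rw [coeff_qm_gq]
            simp [Pi.single_apply, eq_comm]
          · rw [hLr]
            change Ψ j.succ (gq μ b) = _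
            rw [gq, map_sub, hΨ, hΨ, Phi_hom Φ hΦ _ ((lf_hom _).mul (isHomogeneous_X F _))
              (by omega), Phi_hom Φ hΦ _ ((lf_hom _).mul (lf_hom _)) (by omega)]
            simp
        · funext x
          rcases x with a | j
          · rw [hLl]
            change coeff (qm a) (X 0 ^ 2 * lf (c b.succ)) = _
            rw [sq, mul_assoc, coeff_qm_X0]
            simp
          · rw [hLr]
            change Ψ j.succ (X 0 ^ 2 * lf (c b.succ)) = _
            rw [sq, mul_assoc, hΨ, mu_comm hB hμ, mu_one hB hμ]
            have : Φ (lf (t j.succ) * (X 0 * lf (c b.succ))) = BM Φ (t j.succ) (c b.succ) := by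
              rw [BM_apply]; exact congrArg Φ (by ring)
            rw [this, hc]
            simp [Pi.single_apply]
      intro v
      refine ⟨∑ x, v x • G x, ?_, ?_⟩
      · exact Submodule.sum_mem _ fun x _ => Submodule.smul_of_tower_mem _ _ (hGI x)
      · rw [map_sum]
        simp only [map_smul, hLG]
        exact (pi_eq_sum_univ' v).symm

end mu

/-- The curvature matrix. -/
def cm (Q : Fin 3 → Fin 3 → Fin 3 → Fin 3 → F) : Matrix (Fin 3) (Fin 3) F :=
  !![Q 1 1 2 2 - Q 1 2 1 2, Q 1 2 0 2 - Q 1 0 2 2, Q 0 1 1 2 - Q 1 1 0 2;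
    Q 0 2 1 2 - Q 0 1 2 2, Q 0 0 2 2 - Q 0 2 0 2, Q 0 1 0 2 - Q 0 0 1 2;
    Q 0 1 1 2 - Q 0 2 1 1, Q 0 2 0 1 - Q 0 0 1 2, Q 0 0 1 1 - Q 0 1 0 1]

lemma cm_iff (Q : Fin 3 → Fin 3 → Fin 3 → Fin 3 → F)
    (h1 : ∀ i j m l, Q i j m l = Q j i m l) (h3 : ∀ i j m l, Q i j m l = Q m l i j)
    (s : Fin 3 → F) :
    (∀ i j l, s 0 * (Q i j 0 l - Q 0 i j l) + s 1 * (Q i j 1 l - Q 1 i j l)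
      + s 2 * (Q i j 2 l - Q 2 i j l) = 0) ↔ ∀ i, crossProduct (cm Q i) s = 0 := by
  have h2 : ∀ m l i j, Q i j m l = Q i j l m := by
    intro m l i j
    rw [h3, h1, h3]
  have ext3 : ∀ a b c : F, ![a, b, c] = 0 ↔ a = 0 ∧ b = 0 ∧ c = 0 := by
    intro a b c
    constructor
    · intro h
      exact ⟨congrFun h 0, congrFun h 1, congrFun h 2⟩
    · rintro ⟨rfl, rfl, rfl⟩
      funext i; fin_cases i <;> rfl
  simp only [Fin.forall_fin_succ, cross_apply, ext3, cm]
  simp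
  simp only [h1 1 0, h1 2 0, h1 2 1, h2 1 0, h2 2 0, h2 2 1, h3 0 1 0 0,
    h3 0 2 0 0, h3 0 2 0 1, h3 1 1 0 0, h3 1 1 0 1, h3 1 1 0 2, h3 1 2 0 0, h3 1 2 0 1,
    h3 1 2 0 2, h3 1 2 1 1, h3 2 2 0 0, h3 2 2 0 1, h3 2 2 0 2, h3 2 2 1 1, h3 2 2 1 2]
  constructor
  · rintro ⟨⟨⟨g000, g001, g002⟩, ⟨g010, g011, g012⟩, ⟨g020, g021, g022⟩⟩, ⟨⟨g100, g101, g102⟩, ⟨g110, g111, g112⟩, ⟨g120, g121, g122⟩⟩, ⟨⟨g200, g201, g202⟩, ⟨g210, g211, g212⟩, ⟨g220, g221, g222⟩⟩⟩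
    refine ⟨⟨?_, ?_, ?_⟩, ⟨?_, ?_, ?_⟩, ⟨?_, ?_, ?_⟩⟩
    · linear_combination (-1) * g102
    · linear_combination (-1) * g112
    · linear_combination (-1) * g122
    · linear_combination (-1) * g200
    · linear_combination (-1) * g210
    · linear_combination (-1) * g220
    · linear_combination (-1) * g001
    · linear_combination (-1) * g011
    · linear_combination (-1) * g021
  · rintro ⟨⟨c00, c01, c02⟩, ⟨c10, c11, c12⟩, ⟨c20, c21, c22⟩⟩
    refine ⟨⟨⟨?_, ?_, ?_⟩, ⟨?_, ?_, ?_⟩, ⟨?_, ?_, ?_⟩⟩, ⟨⟨?_, ?_, ?_⟩, ⟨?_, ?_, ?_⟩, ⟨?_, ?_, ?_⟩⟩, ⟨⟨?_, ?_, ?_⟩, ⟨?_, ?_, ?_⟩, ⟨?_, ?_, ?_⟩⟩⟩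
    · ring
    · linear_combination (-1) * c20
    · linear_combination (1) * c10
    · ring
    · linear_combination (-1) * c21
    · linear_combination (1) * c11
    · ring
    · linear_combination (-1) * c22
    · linear_combination (1) * c12
    · linear_combination (1) * c20
    · ring
    · linear_combination (-1) * c00
    · linear_combination (1) * c21
    · ring
    · linear_combination (-1) * c01
    · linear_combination (1) * c22
    · ring
    · linear_combination (-1) * c02
    · linear_combination (-1) * c10
    · linear_combination (1) * c00
    · ring
    · linear_combination (-1) * c11
    · linear_combination (1) * c01
    · ring
    · linear_combination (-1) * c12
    · linear_combination (1) * c02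
    · ring

section final

variable {Φ : MvPolynomial (Fin 4) F →ₗ[F] F}
  {μ : (Fin 4 → F) →ₗ[F] (Fin 4 → F) →ₗ[F] (Fin 4 → F)}

lemma ZC_expand (hB : ∀ u, (∀ v, BM Φ u v = 0) → u = 0)
    (hμ : ∀ u v w, BM Φ (μ u v) w = Φ (lf u * lf v * lf w)) (s u v w : Fin 4 → F) :
    BM Φ (μ u v) (μ s w) - BM Φ (μ s u) (μ v w) =
      s 1 * (BM Φ (μ u v) (μ (Pi.single 1 1) w) - BM Φ (μ (Pi.single 1 1) u) (μ v w))
      + s 2 * (BM Φ (μ u v) (μ (Pi.single 2 1) w) - BM Φ (μ (Pi.single 2 1) u) (μ v w))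
      + s 3 * (BM Φ (μ u v) (μ (Pi.single 3 1) w) - BM Φ (μ (Pi.single 3 1) u) (μ v w)) := by
  have h : s = s 0 • Pi.single 0 1 + s 1 • Pi.single 1 1 + s 2 • Pi.single 2 1
      + s 3 • Pi.single 3 1 := by
    funext i
    fin_cases i <;> simp
  have h0 : BM Φ (μ u v) w = BM Φ u (μ v w) := by
    rw [BM_comm Φ u, hμ, hμ]; exact congrArg Φ (by ring)
  generalize s 0 = s0, s 1 = s1, s 2 = s2, s 3 = s3 at h
  subst h
  simp only [map_add, map_smul, LinearMap.add_apply, LinearMap.smul_apply, mu_one hB hμ,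
    smul_eq_mul, h0]
  ring

lemma ZC_iff (hB : ∀ u, (∀ v, BM Φ u v = 0) → u = 0)
    (hμ : ∀ u v w, BM Φ (μ u v) w = Φ (lf u * lf v * lf w)) (s : Fin 4 → F) :
    ZC Φ μ s ↔ ∀ i, crossProduct (cm (fun i j m l : Fin 3 =>
      BM Φ (μ (Pi.single i.succ 1) (Pi.single j.succ 1))
        (μ (Pi.single m.succ 1) (Pi.single l.succ 1))) i) (fun i : Fin 3 => s i.succ) = 0 := by
  have hc := mu_comm hB hμ
  rw [← cm_iff]
  · have key : ∀ i j l : Fin 3, _ := fun i j l =>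
      ZC_expand hB hμ s (Pi.single i.succ 1) (Pi.single j.succ 1) (Pi.single l.succ 1)
    constructor
    · intro h i j l
      have h1 := key i j l
      rw [h, sub_self] at h1
      exact h1.symm
    · intro h
      have hA : ∀ u v w, BM Φ (μ u v) w = BM Φ u (μ v w) := by
        intro u v w
        rw [BM_comm Φ u, hμ, hμ]; exact congrArg Φ (by ring)
      have h1 : ∀ i j l : Fin 3, BM Φ (μ (Pi.single i.succ 1) (Pi.single j.succ 1))
          (μ s (Pi.single l.succ 1)) = BM Φ (μ s (Pi.single i.succ 1))
          (μ (Pi.single j.succ 1) (Pi.single l.succ 1)) := by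
        intro i j l
        rw [← sub_eq_zero, key i j l]
        exact h i j l
      intro u v w
      refine pi_ind (fun u => BM Φ (μ u v) (μ s w) = BM Φ (μ s u) (μ v w)) ?_ ?_ ?_ u
      · intro a b ha hb
        simp only [map_add, LinearMap.add_apply, ha, hb]
      · intro a b hb
        simp only [map_smul, LinearMap.smul_apply, hb]
      intro i
      refine pi_ind (fun v => BM Φ (μ (Pi.single i 1) v) (μ s w) =
        BM Φ (μ s (Pi.single i 1)) (μ v w)) ?_ ?_ ?_ v
      · intro a b ha hb
        simp only [map_add, LinearMap.add_apply, ha, hb]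
      · intro a b hb
        simp only [map_smul, LinearMap.smul_apply, hb]
      intro j
      refine pi_ind (fun w => BM Φ (μ (Pi.single i 1) (Pi.single j 1)) (μ s w) =
        BM Φ (μ s (Pi.single i 1)) (μ (Pi.single j 1) w)) ?_ ?_ ?_ w
      · intro a b ha hb
        simp only [map_add, ha, hb]
      · intro a b hb
        simp only [map_smul, hb]
      intro l
      refine Fin.cases ?_ (fun i => ?_) i
      · rw [mu_one hB hμ, hc s (Pi.single 0 1), mu_one hB hμ, BM_comm,
          BM_comm Φ s]
        simp only [hμ]
        exact congrArg Φ (by ring)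
      refine Fin.cases ?_ (fun j => ?_) j
      · rw [mu_one hB hμ, hc _ (Pi.single 0 1), mu_one hB hμ, BM_comm]
        simp only [hμ]
        exact congrArg Φ (by ring)
      refine Fin.cases ?_ (fun l => ?_) l
      · rw [hc _ (Pi.single 0 1), mu_one hB hμ, hc (Pi.single j.succ 1) (Pi.single 0 1),
          mu_one hB hμ]
        simp only [hμ]
        exact congrArg Φ (by ring)
      exact h1 i j l
  · intro i j m l
    rw [hc (Pi.single i.succ 1)]
  · intro i j m l
    rw [BM_comm]

lemma mem_span_of_cross (n s : Fin 3 → F) (hn : n ≠ 0) (h : crossProduct n s = 0) :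
    ∃ a : F, s = a • n := by
  by_contra! hc
  refine crossProduct_ne_zero_iff_linearIndependent.mpr ?_ h
  rw [LinearIndependent.pair_iff' hn]
  intro a ha
  exact hc a ha.symm

lemma cross_swap (a b : Fin 3 → F) (h : crossProduct a b = 0) : crossProduct b a = 0 := by
  rw [← cross_anticomm, h, neg_zero]

theorem final (hΦ : ∀ m : Fin 4 →₀ ℕ, (m.sum fun _ e => e) ≠ 3 → Φ (monomial m 1) = 0)
    (hB : ∀ u, (∀ v, BM Φ u v = 0) → u = 0)
    (hBs : ∀ f : (Fin 4 → F) →ₗ[F] F, ∃ t, BM Φ t = f)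
    (hμ : ∀ u v w, BM Φ (μ u v) w = Φ (lf u * lf v * lf w))
    (M : Matrix (Fin 3) (Fin 3) F) (hM : M = cm (fun i j m l : Fin 3 =>
      BM Φ (μ (Pi.single i.succ 1) (Pi.single j.succ 1))
        (μ (Pi.single m.succ 1) (Pi.single l.succ 1)))) :
    (M = 0 → Submodule.minSpanRank (annIdeal F Φ) = 9) ∧
    (M.rank = 1 → Submodule.minSpanRank (annIdeal F Φ) = 7) ∧
    (2 ≤ M.rank → Submodule.minSpanRank (annIdeal F Φ) = 6) := by
  have hZ := ZC_iff hB hμ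
  rw [← hM] at hZ
  have hdec : ∀ s : Fin 4 → F, s = s 0 • Pi.single 0 1 + Fin.cons 0 (fun i : Fin 3 => s i.succ) := by
    intro s
    funext i
    refine Fin.cases ?_ (fun i => ?_) i
    · simp
    · simp [Pi.single_apply, Fin.succ_ne_zero]
  have hZ0 : ZC Φ μ (Pi.single 0 1) := by
    rw [hZ]
    intro i
    have : (fun i : Fin 3 => (Pi.single 0 1 : Fin 4 → F) i.succ) = 0 := by
      funext i; simp [Pi.single_apply, Fin.succ_ne_zero]
    rw [this, map_zero]
  refine ⟨fun h0 => ?_, fun h1 => ?_, fun h2 => ?_⟩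
  · have hall : ∀ s, ZC Φ μ s := by
      intro s
      rw [hZ, h0]
      intro i
      have : (0 : Matrix (Fin 3) (Fin 3) F) i = 0 := rfl
      rw [this, map_zero, LinearMap.zero_apply]
    have hb : ⇑(Pi.basisFun F (Fin 4)) = fun i => Pi.single i 1 := by
      funext i; simp
    have := general hΦ hB hBs hμ 3 (fun i => Pi.single i 1) rfl
      (by rw [← hb]; exact (Pi.basisFun F (Fin 4)).linearIndependent)
      (fun i => hall _) (fun s _ => by
        rw [← hb]; exact (Pi.basisFun F (Fin 4)).mem_span s)
    rw [this]; norm_num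
  · rw [Matrix.rank_eq_finrank_span_row] at h1
    obtain ⟨⟨n, hnm⟩, hn0, hn⟩ := finrank_eq_one_iff'.mp h1
    have hn0' : n ≠ 0 := fun h => hn0 (by simp [h])
    have hrow : ∀ i, ∃ a : F, a • n = M i := by
      intro i
      obtain ⟨a, ha⟩ := hn ⟨M i, Submodule.subset_span ⟨i, rfl⟩⟩
      exact ⟨a, congrArg Subtype.val ha⟩
    have hi : ∃ i, M i ≠ 0 := by
      by_contra! hc
      apply hn0'
      have : Submodule.span F (Set.range M.row) ≤ ⊥ := by
        rw [Submodule.span_le]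
        rintro _ ⟨i, rfl⟩
        exact hc i
      exact (Submodule.mem_bot F).mp (this hnm)
    have hZn : ∀ s : Fin 4 → F, ZC Φ μ s ↔ ∃ a : F, (fun i : Fin 3 => s i.succ) = a • n := by
      intro s
      rw [hZ]
      constructor
      · intro h
        obtain ⟨i, hi⟩ := hi
        obtain ⟨a, ha⟩ := hrow i
        obtain ⟨b, hb⟩ := mem_span_of_cross _ _ hi (h i)
        exact ⟨b * a, by rw [hb, ← ha, smul_smul]⟩
      · rintro ⟨a, ha⟩ i
        obtain ⟨b, hb⟩ := hrow i
        rw [ha, ← hb]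
        simp
    have := general hΦ hB hBs hμ 1 ![Pi.single 0 1, Fin.cons 0 n] rfl ?_ ?_ ?_
    · rw [this]; norm_num
    · rw [LinearIndependent.pair_iff]
      intro a b hab
      have e0 := congrFun hab 0
      have ha : a = 0 := by simpa using e0
      refine ⟨ha, ?_⟩
      by_contra hb
      apply hn0'
      funext i
      have e1 := congrFun hab i.succ
      simpa [ha, hb] using e1
    · intro i
      fin_cases i
      · exact hZ0
      · refine (hZn _).mpr ⟨1, ?_⟩
        funext i
        simp
    · intro s hs
      obtain ⟨a, ha⟩ := (hZn s).mp hs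
      rw [hdec s, ha]
      have : (Fin.cons 0 (a • n) : Fin 4 → F) = a • (Fin.cons 0 n : Fin 4 → F) := by
        funext i
        refine Fin.cases ?_ (fun i => ?_) i <;> simp
      rw [this]
      exact add_mem (Submodule.smul_mem _ _ (Submodule.subset_span ⟨0, rfl⟩))
        (Submodule.smul_mem _ _ (Submodule.subset_span ⟨1, rfl⟩))
  · have := general hΦ hB hBs hμ 0 (fun _ => Pi.single 0 1) rfl ?_ (fun _ => hZ0) ?_
    · rw [this]; norm_num
    · change LinearIndependent F (fun _ : Fin 1 => (Pi.single 0 1 : Fin 4 → F))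
      rw [linearIndependent_unique_iff]
      simp
    · intro s hs
      rw [hZ] at hs
      have h0 : (fun i : Fin 3 => s i.succ) = 0 := by
        by_contra hne
        rw [Matrix.rank_eq_finrank_span_row] at h2
        have hle : Submodule.span F (Set.range M.row) ≤
            Submodule.span F {fun i : Fin 3 => s i.succ} := by
          rw [Submodule.span_le]
          rintro _ ⟨i, rfl⟩
          obtain ⟨a, ha⟩ := mem_span_of_cross _ _ hne (cross_swap _ _ (hs i))
          exact Submodule.mem_span_singleton.mpr ⟨a, ha.symm⟩
        have := Submodule.finrank_mono hle
        rw [finrank_span_singleton hne] at this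
        omega
      rw [hdec s, h0]
      have : (Fin.cons 0 (0 : Fin 3 → F) : Fin 4 → F) = 0 := by
        funext i
        refine Fin.cases ?_ (fun i => ?_) i <;> simp
      rw [this, add_zero]
      exact Submodule.smul_mem _ _ (Submodule.subset_span ⟨0, rfl⟩)

end final

end helpers

/-- **Theorem 6.5.**  Assume `Φ` is a degree-3 Macaulay inverse system on
`P = k[x,y,z,w]` whose annihilator contains no nonzero linear form and that `p`
is bijective.  The minimal number of generators of the ideal `ann Φ` equals `9`
if `SM = 0`, equals `7` if `SM` has rank one, and equals `6` if `SM` has rank at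
least two. -/
theorem spanRank_annIdeal_eq_of_rank_smMatrix
    (Φ : MvPolynomial (Fin 4) k →ₗ[k] k)
    (hΦ : ∀ m : Fin 4 →₀ ℕ, (m.sum fun _ e => e) ≠ 3 → Φ (monomial m 1) = 0)
    (hlin : ∀ u ∈ homogeneousSubmodule (Fin 4) k 1, u ∈ annIdeal k Φ → u = 0)
    (hp : Function.Bijective (pMap k Φ))
    (ly2 lyz lyw lz2 lzw lw2 : MvPolynomial (Fin 4) k)
    (hly2m : ly2 ∈ homogeneousSubmodule (Fin 4) k 1)
    (hlyzm : lyz ∈ homogeneousSubmodule (Fin 4) k 1)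
    (hlywm : lyw ∈ homogeneousSubmodule (Fin 4) k 1)
    (hlz2m : lz2 ∈ homogeneousSubmodule (Fin 4) k 1)
    (hlzwm : lzw ∈ homogeneousSubmodule (Fin 4) k 1)
    (hlw2m : lw2 ∈ homogeneousSubmodule (Fin 4) k 1)
    (hly2 : ∀ v ∈ homogeneousSubmodule (Fin 4) k 1,
      Φ (X 0 * ly2 * v) = Φ (X 1 ^ 2 * v))
    (hlyz : ∀ v ∈ homogeneousSubmodule (Fin 4) k 1,
      Φ (X 0 * lyz * v) = Φ (X 1 * X 2 * v))
    (hlyw : ∀ v ∈ homogeneousSubmodule (Fin 4) k 1,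
      Φ (X 0 * lyw * v) = Φ (X 1 * X 3 * v))
    (hlz2 : ∀ v ∈ homogeneousSubmodule (Fin 4) k 1,
      Φ (X 0 * lz2 * v) = Φ (X 2 ^ 2 * v))
    (hlzw : ∀ v ∈ homogeneousSubmodule (Fin 4) k 1,
      Φ (X 0 * lzw * v) = Φ (X 2 * X 3 * v))
    (hlw2 : ∀ v ∈ homogeneousSubmodule (Fin 4) k 1,
      Φ (X 0 * lw2 * v) = Φ (X 3 ^ 2 * v))
    :
    (smMatrix k Φ ly2 lyz lyw lz2 lzw lw2 = 0 →
        (annIdeal k Φ : Submodule _ _).minSpanRank = 9) ∧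
      ((smMatrix k Φ ly2 lyz lyw lz2 lzw lw2).rank = 1 →
        (annIdeal k Φ : Submodule _ _).minSpanRank = 7) ∧
      (2 ≤ (smMatrix k Φ ly2 lyz lyw lz2 lzw lw2).rank →
        (annIdeal k Φ : Submodule _ _).minSpanRank = 6) := by
  have hB : ∀ u, (∀ v, BM Φ u v = 0) → u = 0 := by
    intro u hu
    have h1 : pMap k Φ ⟨lf u, lf_hom u⟩ = 0 := by
      apply LinearMap.ext
      rintro ⟨v, hv⟩
      obtain ⟨v, rfl⟩ := lf_surj v hv
      exact hu v
    have h2 := hp.1 (h1.trans (map_zero _).symm)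
    exact lf_inj u (congrArg Subtype.val h2)
  have hinj : Function.Injective (BM Φ) := by
    rw [injective_iff_map_eq_zero]
    intro u hu
    exact hB u fun v => by rw [hu]; rfl
  have hsurj : Function.Surjective (BM Φ) :=
    (LinearMap.injective_iff_surjective_of_finrank_eq_finrank
      (Subspace.dual_finrank_eq (K := k) (V := Fin 4 → k)).symm).mp hinj
  let e := LinearEquiv.ofBijective (BM Φ) ⟨hinj, hsurj⟩
  let T : (Fin 4 → k) →ₗ[k] (Fin 4 → k) →ₗ[k] ((Fin 4 → k) →ₗ[k] k) :=
    LinearMap.mk₂ k (fun u v => Φ.comp ((LinearMap.mulLeft k (lf u * lf v)).comp lf))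
      (fun u v w => by apply LinearMap.ext; intro x; simp [add_mul, mul_assoc])
      (fun c u v => by apply LinearMap.ext; intro x; simp [mul_assoc])
      (fun u v w => by apply LinearMap.ext; intro x; simp [add_mul, mul_add, mul_assoc])
      (fun c u v => by apply LinearMap.ext; intro x; simp [mul_assoc])
  let μ : (Fin 4 → k) →ₗ[k] (Fin 4 → k) →ₗ[k] (Fin 4 → k) :=
    T.compr₂ e.symm.toLinearMap
  have hμ : ∀ u v w, BM Φ (μ u v) w = Φ (lf u * lf v * lf w) := by
    intro u v w
    have h1 : BM Φ (μ u v) = T u v := e.apply_symm_apply (T u v)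
    rw [h1]; rfl
  have hl : ∀ (l : MvPolynomial (Fin 4) k), l ∈ homogeneousSubmodule (Fin 4) k 1 →
      ∀ a b : Fin 4, (∀ v ∈ homogeneousSubmodule (Fin 4) k 1,
        Φ (X 0 * l * v) = Φ (X a * X b * v)) →
      l = lf (μ (Pi.single a 1) (Pi.single b 1)) := by
    intro l hl a b h
    obtain ⟨l, rfl⟩ := lf_surj l hl
    congr 1
    apply BM_ext hB
    intro w
    rw [hμ, lf_single, lf_single, BM_apply]
    exact h _ (lf_hom w)
  have e1 := hl _ hly2m 1 1 (by simpa only [sq] using hly2)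
  have e2 := hl _ hlyzm 1 2 hlyz
  have e3 := hl _ hlywm 1 3 hlyw
  have e4 := hl _ hlz2m 2 2 (by simpa only [sq] using hlz2)
  have e5 := hl _ hlzwm 2 3 hlzw
  have e6 := hl _ hlw2m 3 3 (by simpa only [sq] using hlw2)
  refine final hΦ hB hsurj hμ _ ?_
  have hQ : ∀ (a b c d : Fin 4), Φ (X a * X b * lf (μ (Pi.single c 1) (Pi.single d 1))) =
      BM Φ (μ (Pi.single a 1) (Pi.single b 1)) (μ (Pi.single c 1) (Pi.single d 1)) := by
    intro a b c d
    rw [hμ, lf_single, lf_single]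
  rw [smMatrix, e2, e3, e4, e5, e6]
  simp only [sq, hQ]
  rfl

end
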